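/- 𝔐 is closed under the commutator: if δ, δ' ∈ 𝔐 then δ∘δ' − δ'∘δ ∈ 𝔐. Consequently 𝔐 is an ℝ-Lie algebra under the commutator bracket. -/

import Mathlib

variable {R : Type*} [CommRing R] [Algebra ℝ R]
variable {M : Type*} [AddCommGroup M] [Module R M] [Module ℝ M] [IsScalarTower ℝ R M]

/-- The product of the trivial square-zero extension `A = R ⊕ M`. -/
def amul (a b : R × M) : R × M := (a.1 * b.1, a.1 • b.2 + b.1 • a.2)

/-- The affine bracket on `A = R ⊕ M`. -/
def abr (pb : R → R → R) (lb : M → M → M) (D : R → M → M) (K : R → R → M)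
    (a b : R × M) : R × M :=
  (pb a.1 b.1, D a.1 b.2 - D b.1 a.2 + lb a.2 b.2 + K a.1 b.1)

/-- A derivation of the algebra `A = R ⊕ M`: an `ℝ`-linear map satisfying Leibniz. -/
def IsADeriv (X : R × M → R × M) : Prop :=
  (∀ a b : R × M, X (a + b) = X a + X b) ∧
  (∀ (r : ℝ) (a : R × M), X (r • a) = r • X a) ∧
  (∀ a b : R × M, X (amul a b) = amul (X a) b + amul a (X b))

/-- A Poisson derivation of the infinitesimal Poisson algebra `A`. -/
def IsPoissonDeriv (pb : R → R → R) (lb : M → M → M) (D : R → M → M) (K : R → R → M)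
    (X : R × M → R × M) : Prop :=
  IsADeriv X ∧
  ∀ a b : R × M, X (abr pb lb D K a b) = abr pb lb D K (X a) b + abr pb lb D K a (X b)

/-- A Hamiltonian derivation of `A`: of the form `{a, ·}ᵃ`. -/
def IsHamiltonian (pb : R → R → R) (lb : M → M → M) (D : R → M → M) (K : R → R → M)
    (X : R × M → R × M) : Prop :=
  ∃ a : R × M, ∀ b : R × M, X b = abr pb lb D K a b

/-- An `ℝ`-linear derivation of `R`. -/
def IsRDeriv (u : R → R) : Prop :=
  (∀ f g : R, u (f + g) = u f + u g) ∧
  (∀ (r : ℝ) (f : R), u (r • f) = r • u f) ∧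
  (∀ f g : R, u (f * g) = u f * g + f * u g)

/-- A derivation `Q : R → M`: an `ℝ`-linear map with `Q (f*g) = f • Q g + g • Q f`. -/
def IsDerivRM (Q : R → M) : Prop :=
  (∀ f g : R, Q (f + g) = Q f + Q g) ∧
  (∀ (r : ℝ) (f : R), Q (r • f) = r • Q f) ∧
  (∀ f g : R, Q (f * g) = f • Q g + g • Q f)

/-- A derivative endomorphism of `M` with symbol `u` (an `ℝ`-linear derivation of `R`). -/
def IsDerivEndo (δ : M → M) (u : R → R) : Prop :=
  (∀ m n : M, δ (m + n) = δ m + δ n) ∧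
  (∀ (r : ℝ) (m : M), δ (r • m) = r • δ m) ∧
  IsRDeriv u ∧
  (∀ (f : R) (m : M), δ (f • m) = f • δ m + u f • m)

/-- Membership in `𝔐`: `δ` is a derivative endomorphism with symbol `u` which is a
derivation of `[·,·]₁`, whose symbol is a Poisson derivation of `R`, and for which a
witness derivation `Q̃ : R → M` satisfying conditions (A) and (B) exists. -/
def MemM (pb : R → R → R) (lb : M → M → M) (D : R → M → M) (K : R → R → M)
    (δ : M → M) (u : R → R) : Prop :=
  IsDerivEndo δ u ∧
  (∀ m n : M, δ (lb m n) = lb (δ m) n + lb m (δ n)) ∧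
  (∀ f g : R, u (pb f g) = pb (u f) g + pb f (u g)) ∧
  ∃ Qt : R → M, IsDerivRM Qt ∧
    (∀ (f : R) (m : M), D f (δ m) - δ (D f m) + D (u f) m = lb (Qt f) m) ∧
    (∀ f g : R, δ (K f g) - K (u f) g - K f (u g) =
      -(D f (Qt g) - D g (Qt f) - Qt (pb f g)))

/-- A `∂_D`-cocycle: a derivation `R → M` with values in the center `Z` of `[·,·]₁`
satisfying `D_f (Q g) - D_g (Q f) = Q {f,g}`. -/
def IsCocycle (pb : R → R → R) (lb : M → M → M) (D : R → M → M) (Q : R → M) : Prop :=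
  IsDerivRM Q ∧
  (∀ (f : R) (m : M), lb (Q f) m = 0) ∧
  (∀ f g : R, D f (Q g) - D g (Q f) = Q (pb f g))

/-- A `∂_D`-coboundary: `Q f = D_f ζ` for some central `ζ`. -/
def IsCoboundary (lb : M → M → M) (D : R → M → M) (Q : R → M) : Prop :=
  ∃ ζ : M, (∀ m : M, lb ζ m = 0) ∧ ∀ f : R, Q f = D f ζ

/-- Membership in `𝒞 + Inn`: `δ = D_f + [η,·]₁` for some `f ∈ R`, `η ∈ M`. -/
def MemCInn (lb : M → M → M) (D : R → M → M) (δ : M → M) : Prop :=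
  ∃ (f : R) (η : M), ∀ m : M, δ m = D f m + lb η m

/-- Membership in `𝒞 = {D_f : f ∈ R}`. -/
def MemC (D : R → M → M) (δ : M → M) : Prop := ∃ f : R, ∀ m : M, δ m = D f m

/-- An additive function between additive groups preserves subtraction. -/
theorem map_sub_of_map_add {A B : Type*} [AddGroup A] [AddGroup B] {φ : A → B}
    (h : ∀ a b, φ (a + b) = φ a + φ b) (a b : A) : φ (a - b) = φ a - φ b :=
  map_sub (AddMonoidHom.mk' φ h) a b

/-- `𝔐` is closed under the commutator; consequently (with closure under addition and
ℝ-scalar multiplication) `𝔐` is an ℝ-Lie algebra under the commutator bracket. -/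
theorem stmt_10
    (pb : R → R → R)
    (pb_add : ∀ f g h : R, pb (f + g) h = pb f h + pb g h)
    (pb_smul : ∀ (r : ℝ) (f g : R), pb (r • f) g = r • pb f g)
    (pb_skew : ∀ f g : R, pb f g = - pb g f)
    (pb_jacobi : ∀ f g h : R, pb f (pb g h) + pb g (pb h f) + pb h (pb f g) = 0)
    (pb_leibniz : ∀ f g h : R, pb f (g * h) = pb f g * h + g * pb f h)
    (lb : M → M → M)
    (lb_add : ∀ m n p : M, lb (m + n) p = lb m p + lb n p)
    (lb_smul : ∀ (f : R) (m n : M), lb (f • m) n = f • lb m n)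
    (lb_smul' : ∀ (f : R) (m n : M), lb m (f • n) = f • lb m n)
    (lb_skew : ∀ m n : M, lb m n = - lb n m)
    (lb_jacobi : ∀ m n p : M, lb m (lb n p) + lb n (lb p m) + lb p (lb m n) = 0)
    (D : R → M → M)
    (D_add_left : ∀ (f g : R) (m : M), D (f + g) m = D f m + D g m)
    (D_smul_left : ∀ (r : ℝ) (f : R) (m : M), D (r • f) m = r • D f m)
    (D_add_right : ∀ (f : R) (m n : M), D f (m + n) = D f m + D f n)
    (D_smul_right : ∀ (f : R) (r : ℝ) (m : M), D f (r • m) = r • D f m)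
    (D_mul : ∀ (f g : R) (m : M), D (f * g) m = f • D g m + g • D f m)
    (D_leibniz : ∀ (f g : R) (m : M), D f (g • m) = g • D f m + pb f g • m)
    (K : R → R → M)
    (K_add : ∀ f g h : R, K (f + g) h = K f h + K g h)
    (K_smul : ∀ (r : ℝ) (f g : R), K (r • f) g = r • K f g)
    (K_skew : ∀ f g : R, K f g = - K g f)
    (K_leibniz : ∀ f g h : R, K f (g * h) = g • K f h + h • K f g)
    (PT1 : ∀ (f : R) (m n : M), D f (lb m n) = lb (D f m) n + lb m (D f n))
    (PT2 : ∀ (f g : R) (m : M), D f (D g m) - D g (D f m) - D (pb f g) m = lb (K f g) m)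
    (PT3 : ∀ f g h : R,
      (D f (K g h) + K f (pb g h)) + (D g (K h f) + K g (pb h f))
        + (D h (K f g) + K h (pb f g)) = 0)
    (faithful : ∀ f : R, (∀ m : M, f • m = 0) → f = 0)
    :
    (∀ (δ δ' : M → M) (u u' : R → R), MemM pb lb D K δ u → MemM pb lb D K δ' u' →
      MemM pb lb D K (fun m => δ (δ' m) - δ' (δ m)) (fun g => u (u' g) - u' (u g))) ∧
    (∀ (δ δ' : M → M) (u u' : R → R), MemM pb lb D K δ u → MemM pb lb D K δ' u' →
      MemM pb lb D K (fun m => δ m + δ' m) (fun g => u g + u' g)) ∧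
    (∀ (r : ℝ) (δ : M → M) (u : R → R), MemM pb lb D K δ u →
      MemM pb lb D K (fun m => r • δ m) (fun g => r • u g)) := by
  have pb_add_right (f g h : R) : pb f (g + h) = pb f g + pb f h := by
    rw [pb_skew f, pb_add, pb_skew f, pb_skew f h]; abel
  have pb_smul_right (r : ℝ) (f g : R) : pb f (r • g) = r • pb f g := by
    rw [pb_skew f, pb_smul, pb_skew f, smul_neg]
  have pb_sub_left (f g h : R) : pb (f - g) h = pb f h - pb g h :=
    map_sub_of_map_add (φ := fun x => pb x h) (fun a b => pb_add a b h) f g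
  have pb_sub_right (f g h : R) : pb f (g - h) = pb f g - pb f h :=
    map_sub_of_map_add (pb_add_right f) g h
  have lb_add_right (m n p : M) : lb m (n + p) = lb m n + lb m p := by
    rw [lb_skew m, lb_add, lb_skew m, lb_skew m p]; abel
  have lb_smul_real (r : ℝ) (m n : M) : lb (r • m) n = r • lb m n := by
    rw [← algebraMap_smul R r m, lb_smul, algebraMap_smul]
  have lb_smul_real_right (r : ℝ) (m n : M) : lb m (r • n) = r • lb m n := by
    rw [← algebraMap_smul R r n, lb_smul', algebraMap_smul]
  have lb_sub_left (m n p : M) : lb (m - n) p = lb m p - lb n p :=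
    map_sub_of_map_add (φ := fun x => lb x p) (fun a b => lb_add a b p) m n
  have lb_sub_right (m n p : M) : lb m (n - p) = lb m n - lb m p :=
    map_sub_of_map_add (lb_add_right m) n p
  have D_sub_left (f g : R) (m : M) : D (f - g) m = D f m - D g m :=
    map_sub_of_map_add (φ := fun x => D x m) (fun a b => D_add_left a b m) f g
  have D_sub_right (f : R) (m n : M) : D f (m - n) = D f m - D f n :=
    map_sub_of_map_add (D_add_right f) m n
  have K_add_right (f g h : R) : K f (g + h) = K f g + K f h := by
    rw [K_skew f, K_add, K_skew f, K_skew f h]; abel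
  have K_smul_right (r : ℝ) (f g : R) : K f (r • g) = r • K f g := by
    rw [K_skew f, K_smul, K_skew f, smul_neg]
  have K_sub_left (f g h : R) : K (f - g) h = K f h - K g h :=
    map_sub_of_map_add (φ := fun x => K x h) (fun a b => K_add a b h) f g
  have K_sub_right (f g h : R) : K f (g - h) = K f g - K f h :=
    map_sub_of_map_add (K_add_right f) g h
  refine ⟨?_, ?_, ?_⟩
  · rintro δ δ' u u'
      ⟨⟨δ_add, δ_smul, ⟨u_add, u_smul, u_mul⟩, δ_leibniz⟩, δ_lb, u_pb,
        Q, ⟨Q_add, Q_smul, Q_mul⟩, hA, hB⟩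
      ⟨⟨δ'_add, δ'_smul, ⟨u'_add, u'_smul, u'_mul⟩, δ'_leibniz⟩, δ'_lb, u'_pb,
        Q', ⟨Q'_add, Q'_smul, Q'_mul⟩, hA', hB'⟩
    have δ_sub := map_sub_of_map_add δ_add
    have δ'_sub := map_sub_of_map_add δ'_add
    have δ_D (f : R) (m : M) : δ (D f m) = D f (δ m) + D (u f) m - lb (Q f) m := by
      rw [← hA]; abel
    have δ'_D (f : R) (m : M) : δ' (D f m) = D f (δ' m) + D (u' f) m - lb (Q' f) m := by
      rw [← hA']; abel
    have δ_K (f g : R) : δ (K f g) =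
        K (u f) g + K f (u g) - D f (Q g) + D g (Q f) + Q (pb f g) := by
      have h := hB f g
      rw [sub_sub, sub_eq_iff_eq_add] at h
      rw [h]; abel
    have δ'_K (f g : R) : δ' (K f g) =
        K (u' f) g + K f (u' g) - D f (Q' g) + D g (Q' f) + Q' (pb f g) := by
      have h := hB' f g
      rw [sub_sub, sub_eq_iff_eq_add] at h
      rw [h]; abel
    refine ⟨⟨?_, ?_, ⟨?_, ?_, ?_⟩, ?_⟩, ?_, ?_,
      fun f => Q (u' f) + δ (Q' f) - Q' (u f) - δ' (Q f), ⟨?_, ?_, ?_⟩, ?_, ?_⟩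
    · intro m n
      simp only [δ_add, δ'_add]; abel
    · intro r m
      simp only [δ_smul, δ'_smul, smul_sub]
    · intro f g
      simp only [u_add, u'_add]; abel
    · intro r f
      simp only [u_smul, u'_smul, smul_sub]
    · intro f g
      simp only [u_mul, u'_mul, u_add, u'_add]; ring
    · intro f m
      simp only [δ_leibniz, δ'_leibniz, δ_add, δ'_add]; module
    · intro m n
      simp only [δ_lb, δ'_lb, δ_add, δ'_add, lb_sub_left, lb_sub_right]; abel
    · intro f g
      simp only [u_pb, u'_pb, u_add, u'_add, pb_sub_left, pb_sub_right]; abel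
    · intro f g
      simp only [u_add, u'_add, Q_add, Q'_add, δ_add, δ'_add]; abel
    · intro r f
      simp only [u_smul, u'_smul, Q_smul, Q'_smul, δ_smul, δ'_smul, smul_sub, smul_add]
    · intro f g
      simp only [u_mul, u'_mul, Q_add, Q'_add, Q_mul, Q'_mul, δ_add, δ'_add,
        δ_leibniz, δ'_leibniz]
      module
    · intro f m
      simp only [δ_D, δ'_D, δ_add, δ'_add, δ_sub, δ'_sub, δ_lb, δ'_lb, D_sub_left, D_sub_right,
        lb_add, lb_sub_left]
      abel
    · intro f g
      simp only [δ_K, δ'_K, δ_D, δ'_D, δ_add, δ'_add, δ_sub, δ'_sub, K_sub_left, K_sub_right,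
        D_add_right, D_sub_right, u_pb, u'_pb, Q_add, Q'_add, lb_skew (Q' _) (Q _)]
      abel
  · rintro δ δ' u u'
      ⟨⟨δ_add, δ_smul, ⟨u_add, u_smul, u_mul⟩, δ_leibniz⟩, δ_lb, u_pb,
        Q, ⟨Q_add, Q_smul, Q_mul⟩, hA, hB⟩
      ⟨⟨δ'_add, δ'_smul, ⟨u'_add, u'_smul, u'_mul⟩, δ'_leibniz⟩, δ'_lb, u'_pb,
        Q', ⟨Q'_add, Q'_smul, Q'_mul⟩, hA', hB'⟩
    refine ⟨⟨?_, ?_, ⟨?_, ?_, ?_⟩, ?_⟩, ?_, ?_, fun f => Q f + Q' f, ⟨?_, ?_, ?_⟩, ?_, ?_⟩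
    · intro m n
      simp only [δ_add, δ'_add]; abel
    · intro r m
      simp only [δ_smul, δ'_smul, smul_add]
    · intro f g
      simp only [u_add, u'_add]; abel
    · intro r f
      simp only [u_smul, u'_smul, smul_add]
    · intro f g
      simp only [u_mul, u'_mul]; ring
    · intro f m
      simp only [δ_leibniz, δ'_leibniz]; module
    · intro m n
      simp only [δ_lb, δ'_lb, lb_add, lb_add_right]; abel
    · intro f g
      simp only [u_pb, u'_pb, pb_add, pb_add_right]; abel
    · intro f g
      simp only [Q_add, Q'_add]; abel
    · intro r f
      simp only [Q_smul, Q'_smul, smul_add]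
    · intro f g
      simp only [Q_mul, Q'_mul]; module
    · intro f m
      simp only [lb_add, ← hA, ← hA', D_add_left, D_add_right]; abel
    · intro f g
      simp only [K_add, K_add_right, D_add_right]
      linear_combination (norm := abel) hB f g + hB' f g
  · rintro r δ u
      ⟨⟨δ_add, δ_smul, ⟨u_add, u_smul, u_mul⟩, δ_leibniz⟩, δ_lb, u_pb,
        Q, ⟨Q_add, Q_smul, Q_mul⟩, hA, hB⟩
    refine ⟨⟨?_, ?_, ⟨?_, ?_, ?_⟩, ?_⟩, ?_, ?_, fun f => r • Q f, ⟨?_, ?_, ?_⟩, ?_, ?_⟩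
    · intro m n
      beta_reduce
      rw [δ_add, smul_add]
    · intro s m
      beta_reduce
      rw [δ_smul, smul_comm]
    · intro f g
      beta_reduce
      rw [u_add, smul_add]
    · intro s f
      beta_reduce
      rw [u_smul, smul_comm]
    · intro f g
      beta_reduce
      rw [u_mul, smul_add, smul_mul_assoc, mul_smul_comm]
    · intro f m
      beta_reduce
      rw [δ_leibniz, smul_add, smul_comm r f, smul_assoc]
    · intro m n
      beta_reduce
      rw [δ_lb, smul_add, lb_smul_real, lb_smul_real_right]
    · intro f g
      beta_reduce
      rw [u_pb, smul_add, pb_smul, pb_smul_right]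
    · intro f g
      beta_reduce
      rw [Q_add, smul_add]
    · intro s f
      beta_reduce
      rw [Q_smul, smul_comm]
    · intro f g
      beta_reduce
      rw [Q_mul, smul_add, smul_comm r f, smul_comm r g]
    · intro f m
      beta_reduce
      rw [lb_smul_real, ← hA, D_smul_right, D_smul_left, smul_add, smul_sub]
    · intro f g
      beta_reduce
      rw [K_smul, K_smul_right, D_smul_right, D_smul_right, ← smul_sub, ← smul_sub, hB,
        ← smul_sub, ← smul_sub, smul_neg]
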